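/- arXiv:2309.12409 — 2 statements merged into one kernel-verified Lean document; each statement's English description precedes it below -/
import Mathlib

section
/- Let u be a classical solution of the nonlocal Allen–Cahn equation ∂ₜu = Δu − ε⁻²W′(u) + λ_ε(t)√(2W(u)) on ℝ^d × [0,T], with λ_ε(t) := −(∫_{ℝ^d} (Δu − ε⁻²W′(u))√(2W(u)) dx) / (∫_{ℝ^d} 2W(u) dx). Then the optimal energy dissipation identity holds: for every t ∈ (0,T), d/dt E_ε[u(·,t)] = −∫_{ℝ^d} ε (∂ₜu(x,t))² dx, where E_ε[v] := ∫_{ℝ^d} ( (ε/2)|∇v|² + ε⁻¹ W(v) ) dx. -/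
open MeasureTheory
open scoped RealInnerProductSpace

/-- The divergence of a vector field on `ℝ^d`. -/
noncomputable def divg {d : ℕ} (F : EuclideanSpace ℝ (Fin d) → EuclideanSpace ℝ (Fin d))
    (x : EuclideanSpace ℝ (Fin d)) : ℝ :=
  ∑ i : Fin d, ⟪fderiv ℝ F x (EuclideanSpace.single i 1), EuclideanSpace.single i 1⟫

/-- The Laplacian `Δf = ∇ · ∇f` on `ℝ^d`. -/
noncomputable def lap {d : ℕ} (f : EuclideanSpace ℝ (Fin d) → ℝ)
    (x : EuclideanSpace ℝ (Fin d)) : ℝ :=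
  divg (gradient f) x

/-- A continuous function vanishing outside a compact set is integrable. -/
lemma Continuous.integrable_of_eq_zero_off_compact {X : Type*} [TopologicalSpace X] [R1Space X]
    [MeasurableSpace X] [OpensMeasurableSpace X] {μ : Measure X} [IsFiniteMeasureOnCompacts μ]
    {f : X → ℝ} {K : Set X} (hf : Continuous f) (hK : IsCompact K) (h0 : ∀ x ∉ K, f x = 0) :
    Integrable f μ :=
  hf.integrable_of_hasCompactSupport (HasCompactSupport.intro hK fun x hx => h0 x hx)

/-- Differentiation under the integral sign for functions supported in a fixed compact set, with
uniformly bounded time derivative. -/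
lemma hasDerivAt_integral_of_eq_zero_off_compact {X : Type*} [TopologicalSpace X] [T2Space X]
    [MeasurableSpace X] [BorelSpace X] {μ : Measure X} [IsFiniteMeasureOnCompacts μ]
    {K : Set X} (hK : IsCompact K) {U : Set ℝ} (hU : IsOpen U) {f f' : ℝ → X → ℝ} {C t : ℝ}
    (ht : t ∈ U) (hf : ∀ s ∈ U, Continuous (f s)) (hf0 : ∀ s ∈ U, ∀ x ∉ K, f s x = 0)
    (hderiv : ∀ x, ∀ s ∈ U, HasDerivAt (fun r => f r x) (f' s x) s)
    (hbound : ∀ s ∈ U, ∀ x ∈ K, ‖f' s x‖ ≤ C) (hf' : Continuous (f' t)) :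
    HasDerivAt (fun s => ∫ x, f s x ∂μ) (∫ x, f' t x ∂μ) t := by
  have hint : ∀ s ∈ U, Integrable (f s) μ := fun s hs =>
    (hf s hs).integrable_of_eq_zero_off_compact hK (hf0 s hs)
  have hf'0 : ∀ s ∈ U, ∀ x ∉ K, f' s x = 0 := fun s hs x hx => by
    refine (hderiv x s hs).unique ((hasDerivAt_const s (0 : ℝ)).congr_of_eventuallyEq ?_)
    filter_upwards [hU.mem_nhds hs] with r hr using hf0 r hr x hx
  refine (hasDerivAt_integral_of_dominated_loc_of_deriv_le (bound := K.indicator fun _ => C)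
    (hU.mem_nhds ht) ?_ (hint t ht)
    (hf'.integrable_of_eq_zero_off_compact hK (hf'0 t ht)).aestronglyMeasurable ?_ ?_ ?_).2
  · filter_upwards [hU.mem_nhds ht] with s hs using (hint s hs).aestronglyMeasurable
  · refine Filter.Eventually.of_forall fun x s hs => ?_
    by_cases hx : x ∈ K
    · simpa [hx] using hbound s hs x hx
    · simp [hx, hf'0 s hs x hx]
  · exact (integrable_indicator_iff hK.measurableSet).2
      (integrableOn_const hK.measure_lt_top.ne)
  · exact Filter.Eventually.of_forall hderiv

/-- A family that is continuous in space at each time and has jointly continuous time derivative is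
uniformly bounded on `[a, b] × K`, together with its time derivative. -/
lemma exists_bound_of_continuousOn_time_deriv {X F : Type*} [TopologicalSpace X]
    [NormedAddCommGroup F] [NormedSpace ℝ F] {K : Set X} (hK : IsCompact K) {a b : ℝ}
    {f f' : ℝ → X → F} (hf : ∀ s ∈ Set.Icc a b, Continuous (f s))
    (hderiv : ∀ x, ∀ s ∈ Set.Icc a b,
      HasDerivWithinAt (fun r => f r x) (f' s x) (Set.Icc a b) s)
    (hf' : ContinuousOn (fun p : ℝ × X => f' p.1 p.2) (Set.Icc a b ×ˢ Set.univ)) :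
    ∃ C, 0 ≤ C ∧ ∀ s ∈ Set.Icc a b, ∀ x ∈ K, ‖f s x‖ ≤ C ∧ ‖f' s x‖ ≤ C := by
  rcases lt_or_ge b a with hab | hab
  · exact ⟨0, le_rfl, fun s hs => absurd (hs.1.trans hs.2) hab.not_ge⟩
  obtain ⟨C₁, hC₁⟩ := (isCompact_Icc.prod hK).exists_bound_of_continuousOn
    (hf'.mono (Set.prod_mono_right (Set.subset_univ K)))
  obtain ⟨C₂, hC₂⟩ := hK.exists_bound_of_continuousOn
    (hf a (Set.left_mem_Icc.2 hab)).continuousOn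
  refine ⟨|C₂| + |C₁| * (b - a) + |C₁|, ?_, fun s hs x hx => ?_⟩
  · have := mul_nonneg (abs_nonneg C₁) (sub_nonneg.2 hab)
    positivity
  have hT := mul_nonneg (abs_nonneg C₁) (sub_nonneg.2 hab)
  have hd : ‖f' s x‖ ≤ |C₁| := (hC₁ (s, x) ⟨hs, hx⟩).trans (le_abs_self _)
  have hmv : ‖f s x - f a x‖ ≤ |C₁| * ‖s - a‖ :=
    (convex_Icc a b).norm_image_sub_le_of_norm_hasDerivWithin_le (hderiv x)
      (fun r hr => (hC₁ (r, x) ⟨hr, hx⟩).trans (le_abs_self _)) (Set.left_mem_Icc.2 hab) hs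
  have hsa : |C₁| * ‖s - a‖ ≤ |C₁| * (b - a) := by
    rw [Real.norm_of_nonneg (sub_nonneg.2 hs.1)]
    gcongr
    exact hs.2
  have h₂ : ‖f a x‖ ≤ |C₂| := (hC₂ x hx).trans (le_abs_self _)
  have htri : ‖f s x‖ ≤ ‖f s x - f a x‖ + ‖f a x‖ := by
    simpa using norm_add_le (f s x - f a x) (f a x)
  constructor
  · linarith [abs_nonneg C₁]
  · linarith [abs_nonneg C₂]

lemma ContDiff.gradient {E : Type*} [NormedAddCommGroup E] [InnerProductSpace ℝ E]
    [CompleteSpace E] {f : E → ℝ} {m n : WithTop ℕ∞} (hf : ContDiff ℝ n f) (hmn : m + 1 ≤ n) :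
    ContDiff ℝ m (gradient f) :=
  (InnerProductSpace.toDual ℝ E).symm.contDiff.comp (hf.fderiv_right hmn)

lemma gradient_eq_zero_of_eq_zero_off_closed {E : Type*} [NormedAddCommGroup E]
    [InnerProductSpace ℝ E] [CompleteSpace E] {f : E → ℝ} {K : Set E} (hK : IsClosed K)
    (h0 : ∀ x ∉ K, f x = 0) {x : E} (hx : x ∉ K) : gradient f x = 0 := by
  have h : f =ᶠ[nhds x] fun _ => 0 := by
    filter_upwards [hK.isOpen_compl.mem_nhds hx] with y hy using h0 y hy
  simp [gradient, h.fderiv_eq]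

lemma continuous_lap {d : ℕ} {f : EuclideanSpace ℝ (Fin d) → ℝ} (hf : ContDiff ℝ 2 f) :
    Continuous (lap f) := by
  have h : Continuous (fderiv ℝ (gradient f)) :=
    (hf.gradient (m := 1) (by norm_num)).continuous_fderiv one_ne_zero
  unfold lap divg
  fun_prop

/-- The first Green identity without boundary terms. -/
lemma integral_inner_gradient_eq_neg_integral_lap_mul {d : ℕ}
    {f g : EuclideanSpace ℝ (Fin d) → ℝ} {K : Set (EuclideanSpace ℝ (Fin d))} (hK : IsCompact K)
    (hf : ContDiff ℝ 2 f) (hg : ContDiff ℝ 1 g) (hg0 : ∀ x ∉ K, g x = 0) :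
    ∫ x, ⟪gradient f x, gradient g x⟫ = -∫ x, lap f x * g x := by
  have hgf : ContDiff ℝ 1 (gradient f) := hf.gradient (by norm_num)
  have hfd : Continuous (fderiv ℝ (gradient f)) := hgf.continuous_fderiv one_ne_zero
  have hgd : Continuous (fderiv ℝ g) := hg.continuous_fderiv one_ne_zero
  have hgc := hg.continuous
  have hfc := hgf.continuous
  have hgd0 : ∀ x ∉ K, fderiv ℝ g x = 0 := fun x hx => by
    rw [← toDual_gradient, gradient_eq_zero_of_eq_zero_off_closed hK.isClosed hg0 hx, map_zero]
  let e : Fin d → EuclideanSpace ℝ (Fin d) := fun i => EuclideanSpace.single i 1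
  have hpartial : ∀ i x, fderiv ℝ (fun y => ⟪gradient f y, e i⟫) x (e i) =
      ⟪fderiv ℝ (gradient f) x (e i), e i⟫ := fun i x => by
    rw [fderiv_inner_apply ℝ (hgf.differentiable one_ne_zero x) (differentiableAt_const _)]
    simp
  have hint₁ : ∀ i, Integrable fun x => ⟪gradient f x, e i⟫ * fderiv ℝ g x (e i) := fun i =>
    Continuous.integrable_of_eq_zero_off_compact (by fun_prop) hK
      fun x hx => by simp [hgd0 x hx]
  have hint₂ : ∀ i, Integrable fun x => ⟪fderiv ℝ (gradient f) x (e i), e i⟫ * g x := fun i =>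
    Continuous.integrable_of_eq_zero_off_compact (by fun_prop) hK
      fun x hx => by simp [hg0 x hx]
  have hparts : ∀ i, ∫ x, ⟪gradient f x, e i⟫ * fderiv ℝ g x (e i) =
      -∫ x, ⟪fderiv ℝ (gradient f) x (e i), e i⟫ * g x := fun i => by
    simp_rw [← hpartial i]
    refine integral_mul_fderiv_eq_neg_fderiv_mul_of_integrable ?_ (hint₁ i) ?_ ?_ ?_
    · simpa only [hpartial i] using hint₂ i
    · exact Continuous.integrable_of_eq_zero_off_compact (by fun_prop) hK
        fun x hx => by simp [hg0 x hx]
    · exact fun x _ => (hgf.differentiable one_ne_zero x).inner ℝ (differentiableAt_const _)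
    · exact fun x _ => hg.differentiable one_ne_zero x
  have hinner : ∀ x, ⟪gradient f x, gradient g x⟫ =
      ∑ i, ⟪gradient f x, e i⟫ * fderiv ℝ g x (e i) := fun x => by
    rw [← (EuclideanSpace.basisFun (Fin d) ℝ).sum_inner_mul_inner]
    refine Finset.sum_congr rfl fun i _ => ?_
    rw [← toDual_gradient, InnerProductSpace.toDual_apply_apply, EuclideanSpace.basisFun_apply,
      real_inner_comm (gradient g x)]
  simp_rw [hinner, lap, divg, Finset.sum_mul]
  rw [integral_finsetSum _ fun i _ => hint₁ i, integral_finsetSum _ fun i _ => hint₂ i,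
    ← Finset.sum_neg_distrib]
  exact Finset.sum_congr rfl fun i _ => hparts i

/-- **Optimal energy dissipation for the nonlocal Allen–Cahn equation.**
If `u` is a classical solution of `∂ₜu = Δu - ε⁻²W'(u) + λ_ε(t)√(2W(u))` on `ℝ^d × [0,T]`,
with the Lagrange multiplier
`λ_ε(t) = -(∫ (Δu - ε⁻²W'(u))√(2W(u)) dx)/(∫ 2W(u) dx)`, then for every `t ∈ (0,T)`,
`d/dt E_ε[u(·,t)] = -∫ ε (∂ₜu)² dx`, where
`E_ε[v] = ∫ ((ε/2)|∇v|² + ε⁻¹W(v)) dx`. -/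
theorem energy_dissipation_nonlocal_allen_cahn
    (d : ℕ) (hd : 1 ≤ d) (ε T : ℝ) (hε : 0 < ε) (hT : 0 < T)
    (W : ℝ → ℝ) (hW : ContDiff ℝ 1 W) (hWnonneg : ∀ z, 0 ≤ W z) (hW0 : W 0 = 0)
    (u ut : ℝ → EuclideanSpace ℝ (Fin d) → ℝ)
    (gut : ℝ → EuclideanSpace ℝ (Fin d) → EuclideanSpace ℝ (Fin d))
    -- `u(·,t)` is C² in space
    (hu_space : ∀ t ∈ Set.Icc (0:ℝ) T, ContDiff ℝ 2 (u t))
    -- `u(x,·)` is C¹ in time, with time derivative `ut`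
    (hu_time : ∀ x, ∀ t ∈ Set.Icc (0:ℝ) T,
      HasDerivWithinAt (fun s => u s x) (ut t x) (Set.Icc 0 T) t)
    (hut_cont : ContinuousOn (fun p : ℝ × EuclideanSpace ℝ (Fin d) => ut p.1 p.2)
      (Set.Icc 0 T ×ˢ Set.univ))
    -- `∇u(x,·)` is also C¹ in time, with time derivative `gut`
    (hgu_time : ∀ x, ∀ t ∈ Set.Icc (0:ℝ) T,
      HasDerivWithinAt (fun s => gradient (u s) x) (gut t x) (Set.Icc 0 T) t)
    (hgut_cont : ContinuousOn (fun p : ℝ × EuclideanSpace ℝ (Fin d) => gut p.1 p.2)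
      (Set.Icc 0 T ×ˢ Set.univ))
    -- uniform compact support
    (K : Set (EuclideanSpace ℝ (Fin d))) (hK : IsCompact K)
    (hsupp : ∀ t ∈ Set.Icc (0:ℝ) T, ∀ x ∉ K, u t x = 0)
    -- nondegeneracy
    (hpos : ∀ t ∈ Set.Icc (0:ℝ) T, 0 < ∫ x, 2 * W (u t x))
    -- the Lagrange multiplier
    (lam : ℝ → ℝ)
    (hlam : ∀ t ∈ Set.Icc (0:ℝ) T, lam t =
      -(∫ x, (lap (u t) x - (ε^2)⁻¹ * deriv W (u t x)) * Real.sqrt (2 * W (u t x))) /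
        (∫ x, 2 * W (u t x)))
    -- the nonlocal Allen–Cahn equation
    (hPDE : ∀ t ∈ Set.Icc (0:ℝ) T, ∀ x, ut t x =
      lap (u t) x - (ε^2)⁻¹ * deriv W (u t x) + lam t * Real.sqrt (2 * W (u t x))) :
    ∀ t ∈ Set.Ioo (0:ℝ) T,
      HasDerivAt (fun s => ∫ x, (ε/2 * ‖gradient (u s) x‖^2 + ε⁻¹ * W (u s x)))
        (-∫ x, ε * (ut t x)^2) t := by
  intro t ht
  have hIoo : Set.Ioo (0 : ℝ) T ⊆ Set.Icc 0 T := Set.Ioo_subset_Icc_self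
  have htI := hIoo ht
  have hcont : ∀ s ∈ Set.Icc (0 : ℝ) T, Continuous (u s) := fun s hs => (hu_space s hs).continuous
  have hgcont : ∀ s ∈ Set.Icc (0 : ℝ) T, Continuous (gradient (u s)) := fun s hs =>
    ((hu_space s hs).gradient (m := 1) (by norm_num)).continuous
  have hg0 : ∀ s ∈ Set.Icc (0 : ℝ) T, ∀ x ∉ K, gradient (u s) x = 0 := fun s hs x hx =>
    gradient_eq_zero_of_eq_zero_off_closed hK.isClosed (hsupp s hs) hx
  have hud : ∀ x, ∀ s ∈ Set.Ioo (0 : ℝ) T, HasDerivAt (fun r => u r x) (ut s x) s :=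
    fun x s hs => (hu_time x s (hIoo hs)).hasDerivAt (Icc_mem_nhds hs.1 hs.2)
  have hgd : ∀ x, ∀ s ∈ Set.Ioo (0 : ℝ) T,
      HasDerivAt (fun r => gradient (u r) x) (gut s x) s :=
    fun x s hs => (hgu_time x s (hIoo hs)).hasDerivAt (Icc_mem_nhds hs.1 hs.2)
  have hutc : Continuous (ut t) :=
    hut_cont.comp_continuous (f := fun x => (t, x)) (by fun_prop) fun x => ⟨htI, trivial⟩
  have hgutc : Continuous (gut t) :=
    hgut_cont.comp_continuous (f := fun x => (t, x)) (by fun_prop) fun x => ⟨htI, trivial⟩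
  have hut0 : ∀ x ∉ K, ut t x = 0 := fun x hx => by
    refine (hud x t ht).unique ((hasDerivAt_const t (0 : ℝ)).congr_of_eventuallyEq ?_)
    filter_upwards [Icc_mem_nhds ht.1 ht.2] with r hr using hsupp r hr x hx
  have hgut0 : ∀ x ∉ K, gut t x = 0 := fun x hx => by
    refine (hgd x t ht).unique ((hasDerivAt_const t 0).congr_of_eventuallyEq ?_)
    filter_upwards [Icc_mem_nhds ht.1 ht.2] with r hr using hg0 r hr x hx
  obtain ⟨A, hA0, hA⟩ := exists_bound_of_continuousOn_time_deriv hK hcont hu_time hut_cont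
  obtain ⟨B, hB0, hB⟩ := exists_bound_of_continuousOn_time_deriv hK hgcont hgu_time hgut_cont
  have hW' : Continuous (deriv W) := hW.continuous_deriv le_rfl
  have hWc : Continuous W := hW.continuous
  have huc := hcont t htI
  have hguc := hgcont t htI
  have hlapc : Continuous (lap (u t)) := continuous_lap (hu_space t htI)
  -- the first variation of the energy along the flow
  have henergy : HasDerivAt (fun s => ∫ x, (ε/2 * ‖gradient (u s) x‖^2 + ε⁻¹ * W (u s x)))
      (∫ x, (ε * ⟪gradient (u t) x, gut t x⟫ + ε⁻¹ * (deriv W (u t x) * ut t x))) t := by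
    obtain ⟨M, hM⟩ := (isCompact_closedBall (0 : ℝ) A).exists_bound_of_continuousOn
      hW'.continuousOn
    refine hasDerivAt_integral_of_eq_zero_off_compact (C := ε * (B * B) + ε⁻¹ * (M * A))
      (f' := fun s x => ε * ⟪gradient (u s) x, gut s x⟫ + ε⁻¹ * (deriv W (u s x) * ut s x))
      hK isOpen_Ioo ht ?_ ?_ ?_ ?_ (by fun_prop)
    · intro s hs
      have h₁ := hcont s (hIoo hs)
      have h₂ := hgcont s (hIoo hs)
      fun_prop
    · intro s hs x hx
      simp [hg0 s (hIoo hs) x hx, hsupp s (hIoo hs) x hx, hW0]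
    · intro x s hs
      have hWd : HasDerivAt W (deriv W (u s x)) (u s x) :=
        (hW.differentiable one_ne_zero _).hasDerivAt
      refine (((hgd x s hs).norm_sq.const_mul (ε/2)).add
        ((hWd.comp s (hud x s hs)).const_mul ε⁻¹)).congr_deriv ?_
      ring
    · intro s hs x hx
      obtain ⟨hA₁, hA₂⟩ := hA s (hIoo hs) x hx
      obtain ⟨hB₁, hB₂⟩ := hB s (hIoo hs) x hx
      have hM₁ : ‖deriv W (u s x)‖ ≤ M := hM _ (by simpa using hA₁)
      have hM0 : 0 ≤ M := (norm_nonneg _).trans hM₁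
      refine (norm_add_le _ _).trans ?_
      rw [norm_mul, norm_mul, norm_mul, Real.norm_of_nonneg hε.le,
        Real.norm_of_nonneg (inv_nonneg.2 hε.le)]
      have hin := norm_inner_le_norm (𝕜 := ℝ) (gradient (u s) x) (gut s x)
      gcongr
      exact hin.trans (by gcongr)
  -- the Green identity against `u s`, differentiated in `s` at `s = t`
  have hgreen : ∫ x, ⟪gradient (u t) x, gut t x⟫ = -∫ x, lap (u t) x * ut t x := by
    obtain ⟨L, hL⟩ := hK.exists_bound_of_continuousOn hlapc.continuousOn
    have h₁ : HasDerivAt (fun s => ∫ x, ⟪gradient (u t) x, gradient (u s) x⟫)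
        (∫ x, ⟪gradient (u t) x, gut t x⟫) t := by
      refine hasDerivAt_integral_of_eq_zero_off_compact (C := B * B)
        (f' := fun s x => ⟪gradient (u t) x, gut s x⟫)
        hK isOpen_Ioo ht ?_ ?_ ?_ ?_ (by fun_prop)
      · intro s hs
        have := hgcont s (hIoo hs)
        fun_prop
      · intro s hs x hx
        simp [hg0 t htI x hx]
      · intro x s hs
        simpa using (hasDerivAt_const s (gradient (u t) x)).inner ℝ (hgd x s hs)
      · intro s hs x hx
        have hB₁ := (hB t htI x hx).1
        have hB₂ := (hB s (hIoo hs) x hx).2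
        exact (norm_inner_le_norm _ _).trans (by gcongr)
    have h₂ : HasDerivAt (fun s => ∫ x, lap (u t) x * u s x) (∫ x, lap (u t) x * ut t x) t := by
      refine hasDerivAt_integral_of_eq_zero_off_compact (C := L * A)
        (f' := fun s x => lap (u t) x * ut s x) hK isOpen_Ioo ht ?_ ?_ ?_ ?_ (by fun_prop)
      · intro s hs
        have := hcont s (hIoo hs)
        fun_prop
      · intro s hs x hx
        simp [hsupp s (hIoo hs) x hx]
      · exact fun x s hs => (hud x s hs).const_mul _
      · intro s hs x hx
        have hL₁ := hL x hx
        have hA₂ := (hA s (hIoo hs) x hx).2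
        have hL0 : 0 ≤ L := (norm_nonneg _).trans hL₁
        rw [norm_mul]
        gcongr
    refine h₁.unique (h₂.neg.congr_of_eventuallyEq ?_)
    filter_upwards [Icc_mem_nhds ht.1 ht.2] with s hs
    exact integral_inner_gradient_eq_neg_integral_lap_mul hK (hu_space t htI)
      ((hu_space s hs).of_le (by norm_num)) (hsupp s hs)
  -- the multiplier makes the flow preserve `∫ √(2W)`
  have horth : ∫ x, Real.sqrt (2 * W (u t x)) * ut t x = 0 := by
    have hsplit : ∀ x, Real.sqrt (2 * W (u t x)) * ut t x =
        (lap (u t) x - (ε^2)⁻¹ * deriv W (u t x)) * Real.sqrt (2 * W (u t x)) +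
          lam t * (2 * W (u t x)) := fun x => by
      have hsq := Real.mul_self_sqrt (mul_nonneg zero_le_two (hWnonneg (u t x)))
      rw [hPDE t htI x]
      linear_combination lam t * hsq
    simp_rw [hsplit]
    rw [integral_add, integral_const_mul, hlam t htI, div_mul_cancel₀ _ (hpos t htI).ne',
      add_neg_cancel]
    · exact Continuous.integrable_of_eq_zero_off_compact (by fun_prop) hK
        fun x hx => by simp [hsupp t htI x hx, hW0]
    · exact Continuous.integrable_of_eq_zero_off_compact (by fun_prop) hK
        fun x hx => by simp [hsupp t htI x hx, hW0]
  refine henergy.congr_deriv ?_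
  have hint₁ : Integrable fun x => ε * ⟪gradient (u t) x, gut t x⟫ :=
    Continuous.integrable_of_eq_zero_off_compact (by fun_prop) hK
      fun x hx => by simp [hgut0 x hx]
  have hint₂ : Integrable fun x => ε⁻¹ * (deriv W (u t x) * ut t x) :=
    Continuous.integrable_of_eq_zero_off_compact (by fun_prop) hK
      fun x hx => by simp [hut0 x hx]
  have hint₃ : Integrable fun x => ε * (lap (u t) x * ut t x) :=
    Continuous.integrable_of_eq_zero_off_compact (by fun_prop) hK
      fun x hx => by simp [hut0 x hx]
  have hint₄ : Integrable fun x => ε * (ut t x)^2 :=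
    Continuous.integrable_of_eq_zero_off_compact (by fun_prop) hK
      fun x hx => by simp [hut0 x hx]
  have hint₅ : Integrable fun x => ε * lam t * (Real.sqrt (2 * W (u t x)) * ut t x) :=
    Continuous.integrable_of_eq_zero_off_compact (by fun_prop) hK
      fun x hx => by simp [hut0 x hx]
  have hpde : ∫ x, (ε * (lap (u t) x * ut t x) - ε⁻¹ * (deriv W (u t x) * ut t x)) =
      ∫ x, (ε * (ut t x)^2 - ε * lam t * (Real.sqrt (2 * W (u t x)) * ut t x)) := by
    refine integral_congr_ae (Filter.Eventually.of_forall fun x => ?_)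
    have hinv : ε * (ε^2)⁻¹ = ε⁻¹ := by field_simp
    linear_combination (-ε * ut t x) * hPDE t htI x + deriv W (u t x) * ut t x * hinv
  rw [integral_sub hint₃ hint₂, integral_sub hint₄ hint₅, integral_const_mul (ε * lam t), horth,
    integral_const_mul ε fun x => lap (u t) x * ut t x] at hpde
  rw [integral_add hint₁ hint₂, integral_const_mul ε fun x => ⟪gradient (u t) x, gut t x⟫, hgreen]
  linarith
end

section
/- The relative energy controls the tilt-excess with density |∇ψ|: ∫_{ℝ^d} |ν_ε(x) − ξ(x)|² |∇ψ(x)| dx ≤ 2 E_rel[u,ξ]. -/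
open MeasureTheory
open scoped RealInnerProductSpace Classical

/-- `∇ψ = √(2W(u)) ∇u`, the gradient of the Modica–Mortola transform `ψ = φ ∘ u`. -/
noncomputable def gradPsi {d : ℕ} (W : ℝ → ℝ) (u : EuclideanSpace ℝ (Fin d) → ℝ)
    (x : EuclideanSpace ℝ (Fin d)) : EuclideanSpace ℝ (Fin d) :=
  Real.sqrt (2 * W (u x)) • gradient u x

/-- The approximate unit normal `ν_ε = -∇u/|∇u|` (with value `e` where `∇u = 0`). -/
noncomputable def nuEps {d : ℕ} (u : EuclideanSpace ℝ (Fin d) → ℝ)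
    (e : EuclideanSpace ℝ (Fin d)) (x : EuclideanSpace ℝ (Fin d)) : EuclideanSpace ℝ (Fin d) :=
  if gradient u x = 0 then e else -(‖gradient u x‖⁻¹ • gradient u x)

/-- The Cahn–Hilliard energy `E_ε[u] = ∫ ((ε/2)|∇u|² + ε⁻¹ W(u)) dx`. -/
noncomputable def cahnHilliardEnergy {d : ℕ} (ε : ℝ) (W : ℝ → ℝ)
    (u : EuclideanSpace ℝ (Fin d) → ℝ) : ℝ :=
  ∫ x, (ε/2 * ‖gradient u x‖^2 + ε⁻¹ * W (u x))

/-- The relative energy `E_rel[u,ξ] = E_ε[u] + ∫ ξ·∇ψ dx`. -/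
noncomputable def relEnergy {d : ℕ} (ε : ℝ) (W : ℝ → ℝ)
    (u : EuclideanSpace ℝ (Fin d) → ℝ)
    (ξ : EuclideanSpace ℝ (Fin d) → EuclideanSpace ℝ (Fin d)) : ℝ :=
  cahnHilliardEnergy ε W u + ∫ x, ⟪ξ x, gradPsi W u x⟫

theorem norm_nuEps {d : ℕ} (u : EuclideanSpace ℝ (Fin d) → ℝ)
    {e : EuclideanSpace ℝ (Fin d)} (he : ‖e‖ = 1) (x : EuclideanSpace ℝ (Fin d)) :
    ‖nuEps u e x‖ = 1 := by
  unfold nuEps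
  split_ifs with h
  · exact he
  · rw [norm_neg, norm_smul, norm_inv, norm_norm, inv_mul_cancel₀ (norm_ne_zero_iff.mpr h)]

theorem gradPsi_eq_neg_norm_smul_nuEps {d : ℕ} (W : ℝ → ℝ)
    (u : EuclideanSpace ℝ (Fin d) → ℝ) (e x : EuclideanSpace ℝ (Fin d)) :
    gradPsi W u x = -(‖gradPsi W u x‖ • nuEps u e x) := by
  unfold gradPsi nuEps
  split_ifs with h
  · simp [h]
  · rw [norm_smul, Real.norm_of_nonneg (Real.sqrt_nonneg _), smul_neg, neg_neg, smul_smul,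
      mul_assoc, mul_inv_cancel₀ (norm_ne_zero_iff.mpr h), mul_one]

/-- Young's inequality bounds `|∇ψ|` by the Cahn–Hilliard energy density. -/
theorem norm_gradPsi_le_energyDensity {d : ℕ} {ε : ℝ} (hε : 0 < ε) {W : ℝ → ℝ}
    (hW : ∀ z, 0 ≤ W z) (u : EuclideanSpace ℝ (Fin d) → ℝ) (x : EuclideanSpace ℝ (Fin d)) :
    ‖gradPsi W u x‖ ≤ ε / 2 * ‖gradient u x‖ ^ 2 + ε⁻¹ * W (u x) := by
  unfold gradPsi
  rw [norm_smul, Real.norm_of_nonneg (Real.sqrt_nonneg _)]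
  have hs : Real.sqrt (2 * W (u x)) ^ 2 = 2 * W (u x) :=
    Real.sq_sqrt (mul_nonneg zero_le_two (hW _))
  set s := Real.sqrt (2 * W (u x))
  set g := ‖gradient u x‖
  have hsquare : ε / 2 * g ^ 2 + ε⁻¹ * W (u x) - s * g = (2 * ε)⁻¹ * (ε * g - s) ^ 2 := by
    rw [show W (u x) = s ^ 2 / 2 by linarith]
    field_simp
    ring
  have : 0 ≤ (2 * ε)⁻¹ * (ε * g - s) ^ 2 := by positivity
  linarith

/-- The pointwise tilt-excess is bounded by twice the relative energy density. -/
theorem tilt_excess_le_relEnergyDensity {d : ℕ} {ε : ℝ} (hε : 0 < ε) {W : ℝ → ℝ}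
    (hW : ∀ z, 0 ≤ W z) (u : EuclideanSpace ℝ (Fin d) → ℝ)
    {e : EuclideanSpace ℝ (Fin d)} (he : ‖e‖ = 1)
    {v : EuclideanSpace ℝ (Fin d)} (hv : ‖v‖ ≤ 1) (x : EuclideanSpace ℝ (Fin d)) :
    ‖nuEps u e x - v‖ ^ 2 * ‖gradPsi W u x‖ ≤
      2 * (ε / 2 * ‖gradient u x‖ ^ 2 + ε⁻¹ * W (u x) + ⟪v, gradPsi W u x⟫) := by
  have hyoung := norm_gradPsi_le_energyDensity hε hW u x
  have hinner : ⟪v, gradPsi W u x⟫ = -(‖gradPsi W u x‖ * ⟪nuEps u e x, v⟫) := by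
    conv_lhs => rw [gradPsi_eq_neg_norm_smul_nuEps W u e x]
    rw [inner_neg_right, real_inner_smul_right, real_inner_comm]
  have hv2 : ‖v‖ ^ 2 ≤ 1 := pow_le_one₀ (norm_nonneg _) hv
  rw [hinner, norm_sub_sq_real, norm_nuEps u he]
  nlinarith [mul_le_mul_of_nonneg_right hv2 (norm_nonneg (gradPsi W u x))]

/-- **The relative energy controls the tilt-excess with density `|∇ψ|`:**
`∫ |ν_ε - ξ|² |∇ψ| dx ≤ 2 E_rel[u,ξ]`. -/
theorem relEnergy_controls_tilt_excess_gradPsi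
    (d : ℕ) (hd : 1 ≤ d) (ε : ℝ) (hε : 0 < ε)
    (W : ℝ → ℝ) (hWc : Continuous W) (hWnonneg : ∀ z, 0 ≤ W z)
    (u : EuclideanSpace ℝ (Fin d) → ℝ) (hu : ContDiff ℝ 1 u)
    (hE : Integrable (fun x => ε/2 * ‖gradient u x‖^2 + ε⁻¹ * W (u x)))
    (hgradPsi : Integrable (gradPsi W u))
    (e : EuclideanSpace ℝ (Fin d)) (he : ‖e‖ = 1)
    (ξ : EuclideanSpace ℝ (Fin d) → EuclideanSpace ℝ (Fin d))
    (hξmeas : Measurable ξ) (hξ1 : ∀ x, ‖ξ x‖ ≤ 1) :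
    (∫ x, ‖nuEps u e x - ξ x‖^2 * ‖gradPsi W u x‖) ≤ 2 * relEnergy ε W u ξ := by
  have hinner : Integrable (fun x => ⟪ξ x, gradPsi W u x⟫) := by
    refine hgradPsi.norm.mono' (hξmeas.aestronglyMeasurable.inner hgradPsi.1) (ae_of_all _ ?_)
    intro x
    exact (norm_inner_le_norm _ _).trans (mul_le_of_le_one_left (norm_nonneg _) (hξ1 x))
  unfold relEnergy cahnHilliardEnergy
  rw [← integral_add hE hinner, ← integral_const_mul]
  refine integral_mono_of_nonneg (ae_of_all _ fun x => by positivity)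
    ((hE.add hinner).const_mul 2) (ae_of_all _ fun x => ?_)
  exact tilt_excess_le_relEnergyDensity hε hWnonneg u he (hξ1 x) x
end
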